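/- If G is a connected graph with minimum degree at least 2 that is not a cycle, then the non-backtracking matrix B of G is irreducible (equivalently, the directed graph on oriented edges with the non-backtracking adjacency relation is strongly connected). -/

import Mathlib

open Matrix

/-- The non-backtracking matrix of a simple graph, indexed by oriented edges (darts):
`B (u,v) (x,y) = 1` iff `v = x` and `u ≠ y`. -/
def nbMatrix {V : Type*} [Fintype V] [DecidableEq V] (G : SimpleGraph V)
    [DecidableRel G.Adj] : Matrix G.Dart G.Dart ℝ :=
  Matrix.of fun d e => if d.toProd.2 = e.toProd.1 ∧ d.toProd.1 ≠ e.toProd.2 then 1 else 0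

namespace SimpleGraph

variable {V : Type*} {G : SimpleGraph V}

/-- A connected graph whose edges join each vertex to its image under a fixed permutation is
isomorphic to a cycle graph. -/
theorem Connected.nonempty_iso_cycleGraph_of_perm [Fintype V] (hconn : G.Connected)
    (σ : Equiv.Perm V) (hσ : ∀ v w, G.Adj v w ↔ σ v = w ∨ σ w = v) :
    Nonempty (G ≃g cycleGraph (Fintype.card V)) := by
  have hcycle : σ.IsCycleOn ((Finset.univ : Finset V) : Set V) := by
    refine ⟨by simp [Set.bijOn_univ], fun x hx y hy ↦ ?_⟩
    clear hx hy
    obtain ⟨p⟩ := hconn.preconnected x y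
    induction p with
    | nil => exact Equiv.Perm.SameCycle.refl σ _
    | cons h _ ih =>
      rcases (hσ _ _).1 h with rfl | rfl
      · exact Equiv.Perm.sameCycle_apply_left.1 ih
      · exact Equiv.Perm.sameCycle_apply_left.2 ih
  obtain ⟨v₀⟩ := hconn.nonempty
  obtain ⟨n, hn⟩ : ∃ n, Fintype.card V = n + 2 := by
    have : Nontrivial V := ⟨v₀, σ v₀, ((hσ v₀ (σ v₀)).2 (Or.inl rfl)).ne⟩
    exact ⟨_, (Nat.sub_add_cancel Fintype.one_lt_card).symm⟩
  rw [← Finset.card_univ] at hn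
  have hpow (i j : ℕ) : (σ ^ i) v₀ = (σ ^ j) v₀ ↔ i ≡ j [MOD n + 2] := by
    rw [← hn]
    exact hcycle.pow_apply_eq_pow_apply (Finset.mem_univ v₀)
  have hbij : Function.Bijective fun i : Fin (n + 2) ↦ (σ ^ (i : ℕ)) v₀ := by
    refine ⟨fun i j hij ↦ Fin.ext (((hpow i j).1 hij).eq_of_lt_of_lt i.2 j.2), fun v ↦ ?_⟩
    obtain ⟨i, hi, rfl⟩ := hcycle.exists_pow_eq (Finset.mem_univ v₀) (Finset.mem_univ v)
    exact ⟨⟨i, hn ▸ hi⟩, rfl⟩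
  have hsucc (i j : Fin (n + 2)) :
      σ ((σ ^ (i : ℕ)) v₀) = (σ ^ (j : ℕ)) v₀ ↔ j - i = 1 := by
    rw [← Equiv.Perm.mul_apply, ← pow_succ', hpow, sub_eq_iff_eq_add', Fin.ext_iff,
      Fin.val_add, Fin.val_one, Nat.ModEq, Nat.mod_eq_of_lt j.2, eq_comm]
  rw [← Finset.card_univ, hn]
  refine ⟨(RelIso.mk (Equiv.ofBijective _ hbij) fun {i j} ↦ ?_).symm⟩
  simp only [Equiv.ofBijective_apply, hσ, hsucc, cycleGraph_adj, or_comm]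

/-- A nonempty set of oriented edges closed under non-backtracking continuation contains every
oriented edge, provided that the graph is connected, of minimum degree at least two, and not a
cycle. -/
theorem Connected.forall_adj_of_nonbacktracking_closed [Fintype V] [DecidableRel G.Adj]
    (hconn : G.Connected) (hdeg : ∀ v, 2 ≤ G.degree v)
    (hcyc : ¬ ∃ n : ℕ, Nonempty (G ≃g cycleGraph n))
    {P : V → V → Prop} (hadj : ∀ {u v}, P u v → G.Adj u v)
    (hclosed : ∀ {u v w}, P u v → G.Adj v w → w ≠ u → P v w)
    (hne : ∃ u v, P u v) {u v : V} (huv : G.Adj u v) : P u v := by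
  classical
  let into (v : V) : Finset V := {u | P u v}
  let out (v : V) : Finset V := {w | P v w}
  have hinto (v : V) : into v ⊆ G.neighborFinset v := fun u hu ↦ by
    simpa using (hadj (Finset.mem_filter.1 hu).2).symm
  have hout (v : V) : out v ⊆ G.neighborFinset v := fun u hu ↦ by
    simpa using hadj (Finset.mem_filter.1 hu).2
  have herase {u v : V} (h : P u v) : (G.neighborFinset v).erase u ⊆ out v := fun w hw ↦ by
    simp only [Finset.mem_erase, mem_neighborFinset] at hw
    simpa [out] using hclosed h hw.2 hw.1
  have hfull {u u' v : V} (h : P u v) (h' : P u' v) (hn : u ≠ u') :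
      out v = G.neighborFinset v := by
    refine (hout v).antisymm fun w hw ↦ ?_
    simp only [mem_neighborFinset] at hw
    by_cases hwu : w = u
    · simpa [out] using hclosed h' hw (hwu ▸ hn)
    · simpa [out] using hclosed h hw hwu
  have hle (v : V) : (into v).card ≤ (out v).card := by
    rcases (into v).eq_empty_or_nonempty with h0 | ⟨u, hu⟩
    · simp [h0]
    have hu' : P u v := (Finset.mem_filter.1 hu).2
    rcases le_or_gt (into v).card 1 with h1 | h1
    · have h2 := Finset.card_le_card (herase hu')
      rw [Finset.card_erase_of_mem (hinto v hu), card_neighborFinset_eq_degree] at h2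
      have := hdeg v
      lia
    · obtain ⟨u', hu1, hn⟩ := Finset.exists_mem_ne h1 u
      rw [hfull hu' (Finset.mem_filter.1 hu1).2 hn.symm]
      exact Finset.card_le_card (hinto v)
  have hcard (v : V) : (into v).card = (out v).card := by
    refine (Finset.sum_eq_sum_iff_of_le fun v _ ↦ hle v).1 ?_ v (Finset.mem_univ v)
    exact (Finset.sum_card_bipartiteAbove_eq_sum_card_bipartiteBelow P).symm
  by_cases hboth : ∃ u v, P u v ∧ P v u
  · have hstep {u v w : V} (h : P u v ∧ P v u) (hw : G.Adj v w) : P v w ∧ P w v := by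
      have hout' : out v = G.neighborFinset v := by
        refine (hout v).antisymm fun x hx ↦ ?_
        by_cases hxu : x = u
        · simpa [out, hxu] using h.2
        · exact herase h.1 (Finset.mem_erase.2 ⟨hxu, hx⟩)
      have hinto' : into v = G.neighborFinset v :=
        Finset.eq_of_subset_of_card_le (hinto v) (by rw [hcard, hout'])
      have hw' : w ∈ G.neighborFinset v := by simpa using hw
      exact ⟨(Finset.mem_filter.1 (hout'.symm ▸ hw' : w ∈ out v)).2,
        (Finset.mem_filter.1 (hinto'.symm ▸ hw' : w ∈ into v)).2⟩
    obtain ⟨a, b, hab⟩ := hboth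
    have hall (v : V) : ∃ u, P u v ∧ P v u := by
      obtain ⟨p⟩ := hconn.preconnected b v
      induction p generalizing a with
      | nil => exact ⟨a, hab⟩
      | cons h _ ih => exact ih _ (hstep hab h)
    obtain ⟨w, hw⟩ := hall u
    exact (hstep hw huv).1
  · exfalso
    push Not at hboth
    have hsucc {u v : V} (h : P u v) : ∃ w, P v w := by
      have h0 : 0 < (out v).card :=
        hcard v ▸ Finset.card_pos.2 ⟨u, by simpa [into] using h⟩
      obtain ⟨w, hw⟩ := Finset.card_pos.1 h0
      exact ⟨w, (Finset.mem_filter.1 hw).2⟩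
    have hpred {v w : V} (h : P v w) : ∃ u, P u v := by
      have h0 : 0 < (into v).card :=
        hcard v ▸ Finset.card_pos.2 ⟨w, by simpa [out] using h⟩
      obtain ⟨u, hu⟩ := Finset.card_pos.1 h0
      exact ⟨u, (Finset.mem_filter.1 hu).2⟩
    have hinj {u u' v : V} (h : P u v) (h' : P u' v) : u = u' := by
      by_contra hn
      exact hboth _ _ h (hclosed h' (hadj h).symm hn)
    have hall (v : V) : ∃ u, P u v := by
      obtain ⟨a, b, hab⟩ := hne
      obtain ⟨p⟩ := hconn.preconnected b v
      induction p generalizing a with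
      | nil => exact ⟨a, hab⟩
      | @cons b c _ h _ ih =>
        by_cases hc : c = a
        · obtain ⟨x, hx⟩ := hpred hab
          exact ih x (hc ▸ hx)
        · exact ih _ (hclosed hab h hc)
    choose σ hσ using fun v ↦ hsucc (hall v).choose_spec
    have hσinj : Function.Injective σ := fun v w h ↦ hinj (hσ v) (h ▸ hσ w)
    have hσuniq {v w : V} (h : P v w) : σ v = w := by
      obtain ⟨x, rfl⟩ := Finite.surjective_of_injective hσinj w
      rw [hinj h (hσ x)]
    refine hcyc ⟨_, hconn.nonempty_iso_cycleGraph_of_perm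
      (Equiv.ofBijective σ (Finite.injective_iff_bijective.1 hσinj)) fun v w ↦ ⟨fun h ↦ ?_, ?_⟩⟩
    · obtain ⟨x, hx⟩ := hall v
      by_cases hw : w = x
      · exact Or.inr (hσuniq (hw ▸ hx))
      · exact Or.inl (hσuniq (hclosed hx h hw))
    · rintro (h | h)
      · exact h ▸ hadj (hσ v)
      · exact h ▸ (hadj (hσ w)).symm

end SimpleGraph

theorem nbMatrix_nonneg {V : Type*} [Fintype V] [DecidableEq V] (G : SimpleGraph V)
    [DecidableRel G.Adj] (d e : G.Dart) : 0 ≤ nbMatrix G d e := by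
  simp only [nbMatrix, Matrix.of_apply]
  split_ifs <;> simp

/-- If `G` is a connected graph with minimum degree at least 2 that is not a cycle, then
the non-backtracking matrix `B` of `G` is irreducible, i.e. the directed graph on darts with
the non-backtracking adjacency relation is strongly connected: for any two darts `d`, `e`
some power of `B` has a strictly positive `(d, e)` entry. -/
theorem nbMatrix_irreducible {V : Type*} [Fintype V] [DecidableEq V] (G : SimpleGraph V)
    [DecidableRel G.Adj] (hconn : G.Connected) (hdeg : ∀ v : V, 2 ≤ G.degree v)
    (hcyc : ¬ ∃ n : ℕ, Nonempty (G ≃g SimpleGraph.cycleGraph n)) :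
    ∀ d e : G.Dart, ∃ k : ℕ, 0 < (nbMatrix G ^ k) d e := by
  intro d e
  have key : ∃ (h : G.Adj e.fst e.snd) (k : ℕ), 0 < (nbMatrix G ^ k) d ⟨(e.fst, e.snd), h⟩ := by
    refine hconn.forall_adj_of_nonbacktracking_closed hdeg hcyc
      (P := fun u v ↦ ∃ (h : G.Adj u v) (k : ℕ), 0 < (nbMatrix G ^ k) d ⟨(u, v), h⟩)
      (fun h ↦ h.1) ?_ ⟨d.fst, d.snd, d.adj, 0, by simp⟩ e.adj
    rintro u v w ⟨huv, k, hk⟩ hvw hwu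
    refine ⟨hvw, k + 1, ?_⟩
    rw [pow_succ, Matrix.mul_apply]
    refine Finset.sum_pos' (fun f _ ↦ mul_nonneg
      (Matrix.pow_apply_nonneg (nbMatrix_nonneg G) k _ _) (nbMatrix_nonneg G _ _))
      ⟨⟨(u, v), huv⟩, Finset.mem_univ _, mul_pos hk ?_⟩
    simp [nbMatrix, hwu.symm]
  exact key.2
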